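/- Let K be a field, S = K[x_1,…,x_n], and let I ⊂ S be a monomial ideal. Then there exists an integer t such that for all k ≥ t the ideal m^k I has linear quotients, where m = (x_1,…,x_n). -/

import Mathlib

/-! # Framework: monomial ideals in `S = K[x_1,…,x_n]`

Monomials are encoded by their exponent vectors in `Fin n →₀ ℕ`; divisibility of
monomials corresponds to the pointwise order, and `u : v = u / gcd(u,v)` corresponds
to truncated subtraction of exponent vectors. -/

open MvPolynomial

noncomputable section

/-- The graded maximal ideal `m = (x_1, …, x_n)` of `K[x_1,…,x_n]`. -/
def maxIdeal (n : ℕ) (K : Type) [Field K] : Ideal (MvPolynomial (Fin n) K) :=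
  Ideal.span (Set.range X)

/-- Exponent vectors of monomials in `n` variables. -/
abbrev Expo (n : ℕ) := Fin n →₀ ℕ

/-- The monomial `x^s` with exponent vector `s`. -/
def mon (n : ℕ) (K : Type) [Field K] (s : Expo n) : MvPolynomial (Fin n) K :=
  monomial s 1

/-- The degree of the monomial with exponent vector `s`. -/
def mdeg {n : ℕ} (s : Expo n) : ℕ := s.sum fun _ e => e

/-- `I` is a monomial ideal: it is generated by monomials. -/
def IsMonomialIdeal (n : ℕ) (K : Type) [Field K]
    (I : Ideal (MvPolynomial (Fin n) K)) : Prop :=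
  ∃ A : Set (Expo n), I = Ideal.span (mon n K '' A)

/-- `G(I)`: the (exponent vectors of the) minimal monomial generators of `I`, i.e. the
monomials of `I` that are minimal with respect to divisibility. -/
def MinGens (n : ℕ) (K : Type) [Field K] (I : Ideal (MvPolynomial (Fin n) K)) :
    Set (Expo n) :=
  {s | mon n K s ∈ I ∧ ∀ t : Expo n, mon n K t ∈ I → t ≤ s → t = s}

/-- Given an order `u_0 < u_1 < ⋯` on monomials, the colon ideal
`(u_0, …, u_{i-1}) : u_i`. -/
def colonPrev (n : ℕ) (K : Type) [Field K] {r : ℕ} (u : Fin r → Expo n) (i : Fin r) :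
    Ideal (MvPolynomial (Fin n) K) :=
  Submodule.colon (Ideal.span (mon n K '' (u '' {l : Fin r | l < i})))
    (Ideal.span {mon n K (u i)})

/-- The ideal `J` is generated by (a set of) variables. -/
def genByVars (n : ℕ) (K : Type) [Field K] (J : Ideal (MvPolynomial (Fin n) K)) : Prop :=
  ∃ T : Set (Fin n), J = Ideal.span ((fun p => (X p : MvPolynomial (Fin n) K)) '' T)

/-- `u` is an admissible order on `G(J)`: it enumerates the minimal monomial
generators, and each colon ideal `(u_0,…,u_{i-1}) : u_i` is generated by variables. -/
def IsLinQuotOrder (n : ℕ) (K : Type) [Field K] (J : Ideal (MvPolynomial (Fin n) K))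
    {r : ℕ} (u : Fin r → Expo n) : Prop :=
  Function.Injective u ∧ Set.range u = MinGens n K J ∧
    ∀ i : Fin r, genByVars n K (colonPrev n K u i)

/-- `J` has linear quotients. -/
def HasLinearQuotients (n : ℕ) (K : Type) [Field K]
    (J : Ideal (MvPolynomial (Fin n) K)) : Prop :=
  ∃ (r : ℕ) (u : Fin r → Expo n), IsLinQuotOrder n K J u

/-- The order `u` is degree increasing. -/
def DegIncr {n r : ℕ} (u : Fin r → Expo n) : Prop :=
  ∀ i i' : Fin r, i ≤ i' → mdeg (u i) ≤ mdeg (u i')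

/-- The numerical invariant `λ_{I,O,u_i} = Σ_k (deg w_{i,k} - 1)`, where the `w_{i,k}`
are the minimal monomial generators of `(u_0,…,u_{i-1}) : u_i`. -/
def lamOrd (n : ℕ) (K : Type) [Field K] {r : ℕ} (u : Fin r → Expo n) (i : Fin r) : ℕ :=
  ∑ᶠ w ∈ MinGens n K (colonPrev n K u i), (mdeg w - 1)

end

/-- `v` lies in the ideal generated by the `x^a` with `a ∈ A`, multiplied by the `k`-th power of the
graded maximal ideal. -/
def IsShifted {n : ℕ} (A : Set (Expo n)) (k : ℕ) (v : Expo n) : Prop :=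
  ∃ a ∈ A, a ≤ v ∧ a.degree + k ≤ v.degree

/-- The sorting key: degree first, then the deficit below the exponent bound `c`, then
lexicographically. -/
noncomputable def sortKey {n : ℕ} (c : ℕ) (v : Expo n) : ℕ ×ₗ (ℕ ×ₗ Lex (Fin n → ℕ)) :=
  toLex (v.degree, toLex (∑ i, (c - v i), toLex ⇑v))

theorem sortKey_injective {n : ℕ} (c : ℕ) : Function.Injective (sortKey (n := n) c) := by
  intro u v h
  have h' := congrArg (fun x => ofLex (ofLex (ofLex x).2).2) h
  exact DFunLike.coe_injective h'

theorem sortKey_lt_iff {n : ℕ} {c : ℕ} {u v : Expo n} :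
    sortKey c u < sortKey c v ↔ u.degree < v.degree ∨ u.degree = v.degree ∧
      (∑ i, (c - u i) < ∑ i, (c - v i) ∨ ∑ i, (c - u i) = ∑ i, (c - v i) ∧
        ∃ i, (∀ j < i, u j = v j) ∧ u i < v i) := by
  simp only [sortKey, Prod.Lex.toLex_lt_toLex]
  rfl

theorem sortKey_mono {n : ℕ} {c : ℕ} {u v : Expo n} (h : u ≤ v) : sortKey c u ≤ sortKey c v := by
  rcases eq_or_ne u v with rfl | hne
  · exact le_rfl
  · obtain ⟨b, rfl⟩ := le_iff_exists_add.1 h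
    refine (sortKey_lt_iff.2 (Or.inl ?_)).le
    rw [map_add]
    have : b.degree ≠ 0 := fun hb => hne (by rw [(Finsupp.degree_eq_zero_iff b).1 hb, add_zero])
    omega

theorem exists_lt_apply_of_mul_lt_degree {n c : ℕ} {v : Expo n} (h : n * c < v.degree) :
    ∃ j, c < v j := by
  by_contra! hv
  have := Finset.sum_le_card_nsmul Finset.univ v c fun i _ => hv i
  rw [← Finsupp.degree_eq_sum] at this
  simp at this
  omega

section Exchange

variable {n : ℕ} {A : Set (Expo n)} {c k : ℕ}

theorem degree_sub_single {v : Expo n} {j : Fin n} (hj : 0 < v j) :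
    (v - Finsupp.single j 1).degree + 1 = v.degree := by
  have h : v - Finsupp.single j 1 + Finsupp.single j 1 = v :=
    tsub_add_cancel_of_le (by simpa [Nat.one_le_iff_ne_zero] using hj.ne')
  conv_rhs => rw [← h]
  simp

theorem le_sub_single {a v : Expo n} {j : Fin n} (h : a ≤ v) (hj : a j < v j) :
    a ≤ v - Finsupp.single j 1 := by
  intro i
  rcases eq_or_ne j i with rfl | hi
  · simp; omega
  · simpa [Finsupp.single_eq_of_ne' hi] using h i

theorem IsShifted.exchange (hA : ∀ a ∈ A, ∀ i, a i ≤ c) {v : Expo n} (hv : IsShifted A k v)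
    {j : Fin n} (hj : c < v j) (p : Fin n) :
    IsShifted A k (v - Finsupp.single j 1 + Finsupp.single p 1) := by
  obtain ⟨a, ha, hav, hd⟩ := hv
  refine ⟨a, ha, (le_sub_single hav ((hA a ha j).trans_lt hj)).trans le_self_add, ?_⟩
  have := degree_sub_single (v := v) (j := j) (by omega)
  simp
  omega

theorem exists_minimal_sortKey_lt (hA : ∀ a ∈ A, ∀ i, a i ≤ c) {v : Expo n}
    (hv : IsShifted A k v) {j p : Fin n} (hj : c < v j)
    (hlt : sortKey c (v - Finsupp.single j 1 + Finsupp.single p 1) < sortKey c v) :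
    ∃ w, Minimal (IsShifted A k) w ∧ sortKey c w < sortKey c v ∧
      w ≤ Finsupp.single p 1 + v := by
  obtain ⟨w, hw, hmin⟩ :=
    exists_minimal_le_of_wellFoundedLT (IsShifted A k) _ (hv.exchange hA hj p)
  refine ⟨w, hmin, (sortKey_mono hw).trans_lt hlt, hw.trans ?_⟩
  rw [add_comm]
  exact add_le_add le_rfl tsub_le_self

theorem degree_exchange {v : Expo n} {j : Fin n} (hj : 0 < v j) (p : Fin n) :
    (v - Finsupp.single j 1 + Finsupp.single p 1).degree = v.degree := by
  rw [← degree_sub_single hj]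
  simp

/-- The combinatorial core: for `k` large, the minimal exponents sorted by `sortKey` satisfy the
exchange property that characterises linear quotients. -/
theorem linear_exchange (hA : ∀ a ∈ A, ∀ i, a i ≤ c) (hk : n * c < k) {u v : Expo n}
    (hu : IsShifted A k u) (hv : Minimal (IsShifted A k) v)
    (huv : sortKey c u < sortKey c v) :
    ∃ p, v p < u p ∧ ∃ w, Minimal (IsShifted A k) w ∧ sortKey c w < sortKey c v ∧
      w ≤ Finsupp.single p 1 + v := by
  obtain ⟨j, hj⟩ : ∃ j, c < v j := by
    obtain ⟨a, -, -, h⟩ := hv.prop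
    exact exists_lt_apply_of_mul_lt_degree (by omega)
  by_cases hp : ∃ p, v p < c ∧ v p < u p
  · obtain ⟨p, hpc, hpu⟩ := hp
    refine ⟨p, hpu, exists_minimal_sortKey_lt hA hv.prop hj (sortKey_lt_iff.2 (Or.inr
      ⟨degree_exchange (by omega) p, Or.inl (Finset.sum_lt_sum (fun i _ => ?_)
        ⟨p, Finset.mem_univ _, ?_⟩)⟩))⟩
    · simp only [Finsupp.add_apply, Finsupp.tsub_apply, Finsupp.single_apply]
      split_ifs <;> subst_vars <;> omega
    · simp only [Finsupp.add_apply, Finsupp.tsub_apply, Finsupp.single_apply]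
      split_ifs <;> subst_vars <;> omega
  push Not at hp
  have hle : ∀ i, c - v i ≤ c - u i := fun i => by
    have := hp i
    omega
  rcases sortKey_lt_iff.1 huv with hdeg | ⟨hdeg, hsum | ⟨hsum, q, hq, hqlt⟩⟩
  · exfalso
    obtain ⟨a, ha, hau, hd⟩ := hu
    have hav : a ≤ v := fun i => by
      have h1 := hle i
      have h2 := hau i
      have h3 := hA a ha i
      omega
    have hs := degree_sub_single (v := v) (j := j) (by omega)
    have hmin := hv.le_of_le (y := v - Finsupp.single j 1)
      ⟨a, ha, le_sub_single hav ((hA a ha j).trans_lt hj), by omega⟩ tsub_le_self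
    have := Finsupp.degree_mono hmin
    omega
  · exact absurd hsum (Finset.sum_le_sum fun i _ => hle i).not_gt
  · have heq : ∀ i, c - v i = c - u i := fun i =>
      (Finset.sum_eq_sum_iff_of_le fun i _ => hle i).1 hsum.symm i (Finset.mem_univ i)
    obtain ⟨p, hpu⟩ : ∃ p, v p < u p := by
      by_contra! h
      have := Finset.sum_lt_sum (fun i _ => h i) ⟨q, Finset.mem_univ q, hqlt⟩
      rw [← Finsupp.degree_eq_sum, ← Finsupp.degree_eq_sum] at this
      omega
    have hqp : q < p := by
      rcases lt_trichotomy p q with h | rfl | h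
      · have := hq p h
        omega
      · omega
      · exact h
    have hqc := heq q
    have hpc := heq p
    have hvq : c < v q := by omega
    refine ⟨p, hpu, exists_minimal_sortKey_lt hA hv.prop hvq (sortKey_lt_iff.2 (Or.inr
      ⟨degree_exchange (by omega) p, Or.inr ⟨Finset.sum_congr rfl fun i _ => ?_, q, ?_, ?_⟩⟩))⟩
    · simp only [Finsupp.add_apply, Finsupp.tsub_apply, Finsupp.single_apply]
      split_ifs <;> subst_vars <;> omega
    · intro i hi
      simp [Finsupp.single_eq_of_ne hi.ne, Finsupp.single_eq_of_ne (hi.trans hqp).ne]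
    · simp [Finsupp.single_eq_of_ne hqp.ne]
      omega

end Exchange

theorem Set.Finite.exists_enum_strictMono {α β : Type*} [LinearOrder β] {s : Set α}
    (hs : s.Finite) {f : α → β} (hf : Function.Injective f) :
    ∃ (r : ℕ) (u : Fin r → α), Set.range u = s ∧ StrictMono (f ∘ u) := by
  let t := hs.toFinset.map ⟨f, hf⟩
  have h : ∀ i, ∃ a ∈ s, f a = t.orderEmbOfFin rfl i := fun i => by
    have := t.orderEmbOfFin_mem rfl i
    generalize (t.orderEmbOfFin rfl) i = b at this ⊢
    simpa [t] using this
  choose u hu hfu using h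
  refine ⟨t.card, u, ?_, fun i j hij => by simpa [hfu] using hij⟩
  refine (Set.range_subset_iff.2 hu).antisymm fun a ha => ?_
  have : f a ∈ Set.range (t.orderEmbOfFin rfl) := by
    rw [Finset.range_orderEmbOfFin]
    simpa [t] using ⟨a, ha, rfl⟩
  obtain ⟨i, hi⟩ := this
  exact ⟨i, hf ((hfu i).trans hi)⟩

section Ideals

variable {n : ℕ} {K : Type} [Field K]

theorem mem_span_mon_iff {B : Set (Expo n)} {p : MvPolynomial (Fin n) K} :
    p ∈ Ideal.span (mon n K '' B) ↔ ∀ s ∈ p.support, ∃ b ∈ B, b ≤ s :=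
  mem_ideal_span_monomial_image

theorem mon_mem_span_mon_iff {B : Set (Expo n)} {s : Expo n} :
    mon n K s ∈ Ideal.span (mon n K '' B) ↔ ∃ b ∈ B, b ≤ s := by
  rw [mem_span_mon_iff]
  simp [mon]

theorem exists_bounded_generators (A : Set (Expo n)) :
    ∃ (B : Set (Expo n)) (c : ℕ), (∀ b ∈ B, ∀ i, b i ≤ c) ∧
      Ideal.span (mon n K '' A) = Ideal.span (mon n K '' B) := by
  have hfin : {a | Minimal (· ∈ A) a}.Finite :=
    WellQuasiOrderedLE.finite_of_isAntichain (setOfPred_minimal_antichain (· ∈ A))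
  obtain ⟨c, hc⟩ := (hfin.image Finsupp.degree).bddAbove
  refine ⟨{a | Minimal (· ∈ A) a}, c, fun b hb i => ?_, le_antisymm ?_ ?_⟩
  · exact (Finsupp.le_degree i b).trans (hc ⟨b, hb, rfl⟩)
  · rw [Ideal.span_le]
    rintro _ ⟨a, ha, rfl⟩
    obtain ⟨b, hba, hb⟩ := exists_minimal_le_of_wellFoundedLT (· ∈ A) a ha
    exact mon_mem_span_mon_iff.2 ⟨b, hb, hba⟩
  · exact Ideal.span_mono (Set.image_mono fun a ha => ha.prop)

theorem mon_mem_maxIdeal_pow_mul_iff {A : Set (Expo n)} {k : ℕ} {s : Expo n} :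
    mon n K s ∈ maxIdeal n K ^ k * Ideal.span (mon n K '' A) ↔ IsShifted A k s := by
  have h : maxIdeal n K ^ k * Ideal.span (mon n K '' A) =
      Ideal.span (mon n K '' {s | ∃ b a, b.degree = k ∧ a ∈ A ∧ b + a = s}) := by
    have hm : maxIdeal n K ^ k = Ideal.span (mon n K '' (Finsupp.degree ⁻¹' {k})) :=
      pow_idealOfVars_eq_span k
    rw [hm, Ideal.span_mul_span']
    congr 1
    ext p
    simp only [Set.mem_mul, Set.mem_image, Set.mem_preimage, Set.mem_singleton_iff,
      Set.mem_ofPred_eq]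
    constructor
    · rintro ⟨_, ⟨b, hb, rfl⟩, _, ⟨a, ha, rfl⟩, rfl⟩
      exact ⟨b + a, ⟨b, a, hb, ha, rfl⟩, by simp [mon, monomial_mul]⟩
    · rintro ⟨_, ⟨b, a, hb, ha, rfl⟩, rfl⟩
      exact ⟨_, ⟨b, hb, rfl⟩, _, ⟨a, ha, rfl⟩, by simp [mon, monomial_mul]⟩
  rw [h, mon_mem_span_mon_iff]
  constructor
  · rintro ⟨_, ⟨b, a, rfl, ha, rfl⟩, hs⟩
    refine ⟨a, ha, le_add_self.trans hs, ?_⟩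
    have := Finsupp.degree_mono hs
    rw [map_add] at this
    omega
  · rintro ⟨a, ha, has, hd⟩
    obtain ⟨d, rfl⟩ := le_iff_exists_add.1 has
    rw [map_add] at hd
    obtain ⟨b, hbd, hb⟩ := Finsupp.exists_le_degree_eq d k (by omega)
    exact ⟨b + a, ⟨b, a, hb, ha, rfl⟩, by rw [add_comm a]; exact add_le_add hbd le_rfl⟩

theorem minGens_maxIdeal_pow_mul {A : Set (Expo n)} {k : ℕ} :
    MinGens n K (maxIdeal n K ^ k * Ideal.span (mon n K '' A)) =
      {s | Minimal (IsShifted A k) s} := by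
  ext s
  simp only [MinGens, mon_mem_maxIdeal_pow_mul_iff, Set.mem_ofPred_eq]
  exact ⟨fun h => ⟨h.1, fun t ht hts => (h.2 t ht hts).ge⟩,
    fun h => ⟨h.prop, fun t ht hts => h.eq_of_le ht hts⟩⟩

theorem mem_colonPrev_iff {r : ℕ} {u : Fin r → Expo n} {i : Fin r}
    {p : MvPolynomial (Fin n) K} :
    p ∈ colonPrev n K u i ↔ ∀ s ∈ p.support, ∃ l < i, u l ≤ s + u i := by
  rw [colonPrev, Submodule.mem_colon_span_singleton, smul_eq_mul, mem_span_mon_iff, mon]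
  constructor
  · intro h s hs
    obtain ⟨_, ⟨l, hl, rfl⟩, hle⟩ := h (s + u i) (by
      rw [mem_support_iff, coeff_mul_monomial, mul_one]
      exact mem_support_iff.1 hs)
    exact ⟨l, hl, hle⟩
  · intro h s hs
    rw [mem_support_iff, coeff_mul_monomial'] at hs
    split_ifs at hs with hle
    · obtain ⟨l, hl, hl'⟩ := h (s - u i) (mem_support_iff.2 (by simpa using hs))
      rw [tsub_add_cancel_of_le hle] at hl'
      exact ⟨_, ⟨l, hl, rfl⟩, hl'⟩
    · exact absurd rfl hs

theorem genByVars_colonPrev {r : ℕ} {u : Fin r → Expo n} {i : Fin r}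
    (h : ∀ l < i, ∃ p, u i p < u l p ∧ ∃ l' < i, u l' ≤ Finsupp.single p 1 + u i) :
    genByVars n K (colonPrev n K u i) := by
  refine ⟨{p | ∃ l < i, u l ≤ Finsupp.single p 1 + u i}, ?_⟩
  ext f
  rw [mem_colonPrev_iff]
  refine Iff.trans (forall₂_congr fun s _ => ?_) mem_ideal_span_X_image.symm
  constructor
  · rintro ⟨l, hl, hls⟩
    obtain ⟨p, hp, hpT⟩ := h l hl
    refine ⟨p, hpT, ?_⟩
    have := hls p
    rw [Finsupp.add_apply] at this
    omega
  · rintro ⟨p, ⟨l, hl, hlp⟩, hs⟩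
    refine ⟨l, hl, hlp.trans (add_le_add ?_ le_rfl)⟩
    simpa [Nat.one_le_iff_ne_zero] using hs

end Ideals

/-- **Theorem (Ficarra–Herzog–Moradi).** Let `K` be a field and `I ⊂ S = K[x_1,…,x_n]`
a monomial ideal. Then there exists an integer `t` such that for all `k ≥ t` the ideal
`m^k I` has linear quotients, where `m = (x_1, …, x_n)`. -/
theorem powers_eventually_linear_quotients (n : ℕ) (K : Type) [Field K]
    (I : Ideal (MvPolynomial (Fin n) K)) (hI : IsMonomialIdeal n K I) :
    ∃ t : ℕ, ∀ k : ℕ, t ≤ k → HasLinearQuotients n K (maxIdeal n K ^ k * I) := by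
  obtain ⟨A, rfl⟩ := hI
  obtain ⟨B, c, hB, hAB⟩ := exists_bounded_generators (K := K) A
  rw [hAB]
  refine ⟨n * c + 1, fun k hk => ?_⟩
  have hfin : {s | Minimal (IsShifted B k) s}.Finite :=
    WellQuasiOrderedLE.finite_of_isAntichain (setOfPred_minimal_antichain (IsShifted B k))
  obtain ⟨r, u, hu, hmono⟩ := hfin.exists_enum_strictMono (sortKey_injective c)
  have hmin : ∀ i, Minimal (IsShifted B k) (u i) := fun i => hu.subset ⟨i, rfl⟩
  refine ⟨r, u, hmono.injective.of_comp, by rw [hu, minGens_maxIdeal_pow_mul],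
    fun i => genByVars_colonPrev fun l hl => ?_⟩
  obtain ⟨p, hp, w, hw, hlt, hle⟩ :=
    linear_exchange hB (by omega) (hmin l).prop (hmin i) (hmono hl)
  obtain ⟨l', rfl⟩ := hu.superset hw
  exact ⟨p, hp, l', hmono.lt_iff_lt.1 hlt, hle⟩
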